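/- If φ : Γ → Γ is one-to-one and has no periodic point, then for any compatible metric d on X^Γ there exist an uncountable subset M of X^Γ consisting of transitive points of σ_φ and a real number r > 0 such that for all distinct x, y ∈ M: F*_{xy}(t) = 1 for all t > 0, and F_{xy}(r) = 0 (F and F* computed with respect to f = σ_φ). -/

import Mathlib

open Filter Topology

/-- `d : Y → Y → ℝ` is a metric on the topological space `Y` compatible with
(i.e. inducing) its topology. -/
def IsCompatibleMetric (Y : Type*) [t : TopologicalSpace Y] (d : Y → Y → ℝ) : Prop :=
  ∃ m : MetricSpace Y, m.toUniformSpace.toTopologicalSpace = t ∧ ∀ a b, m.dist a b = d a b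

/-- The generalized shift `σ_φ : X^Γ → X^Γ`, `σ_φ((x_α)_α) = (x_{φ(α)})_α`. -/
def genShift {X Γ : Type*} (φ : Γ → Γ) (x : Γ → X) : Γ → X := fun α => x (φ α)

/-- `θ` is a quasi-periodic point of `φ` iff its forward orbit `{φ^n(θ) : n ≥ 0}` is finite. -/
def QuasiPeriodic {Γ : Type*} (φ : Γ → Γ) (θ : Γ) : Prop :=
  (Set.range fun n : ℕ => φ^[n] θ).Finite

/-- `θ` is a periodic point of `φ` iff `φ^n(θ) = θ` for some `n ≥ 1`. -/
def PeriodicPt {Γ : Type*} (φ : Γ → Γ) (θ : Γ) : Prop := ∃ n ≥ 1, φ^[n] θ = θ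

/-- `ξ(x,y,t,n) = #{i ∈ {0,…,n−1} : d(f^i(x), f^i(y)) < t}`. -/
noncomputable def xiCount {Y : Type*} (d : Y → Y → ℝ) (f : Y → Y) (x y : Y) (t : ℝ) (n : ℕ) :
    ℕ :=
  {i : ℕ | i < n ∧ d (f^[i] x) (f^[i] y) < t}.ncard

/-- `F_{xy}(t) = liminf_n ξ(x,y,t,n)/n`. -/
noncomputable def Fdist {Y : Type*} (d : Y → Y → ℝ) (f : Y → Y) (x y : Y) (t : ℝ) : ℝ :=
  liminf (fun n : ℕ => (xiCount d f x y t n : ℝ) / n) atTop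

/-- `F*_{xy}(t) = limsup_n ξ(x,y,t,n)/n`. -/
noncomputable def FdistStar {Y : Type*} (d : Y → Y → ℝ) (f : Y → Y) (x y : Y) (t : ℝ) : ℝ :=
  limsup (fun n : ℕ => (xiCount d f x y t n : ℝ) / n) atTop

/-- `ζ(x,y,γ_D,n) = #{i ∈ {0,…,n−1} : (f^i(x), f^i(y)) ∈ γ_D}` where
`γ_D = {(u,v) : u_α = v_α for all α ∈ D}`. -/
noncomputable def zetaCount {X Γ : Type*} (f : (Γ → X) → (Γ → X)) (x y : Γ → X) (D : Set Γ)
    (n : ℕ) : ℕ :=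
  {i : ℕ | i < n ∧ ∀ α ∈ D, f^[i] x α = f^[i] y α}.ncard

/-- `G_{xy}(γ_D) = liminf_n ζ(x,y,γ_D,n)/n`. -/
noncomputable def Gdist {X Γ : Type*} (f : (Γ → X) → (Γ → X)) (x y : Γ → X) (D : Set Γ) : ℝ :=
  liminf (fun n : ℕ => (zetaCount f x y D n : ℝ) / n) atTop

/-- `G*_{xy}(γ_D) = limsup_n ζ(x,y,γ_D,n)/n`. -/
noncomputable def GdistStar {X Γ : Type*} (f : (Γ → X) → (Γ → X)) (x y : Γ → X) (D : Set Γ) :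
    ℝ :=
  limsup (fun n : ℕ => (zetaCount f x y D n : ℝ) / n) atTop

/-- `x, y` are distributionally scrambled of type 1 (w.r.t. the metric `d` and the map `f`). -/
def DistScrambled1 {Y : Type*} (d : Y → Y → ℝ) (f : Y → Y) (x y : Y) : Prop :=
  (∃ s > 0, Fdist d f x y s = 0) ∧ ∀ s > 0, FdistStar d f x y s = 1

/-- `x, y` are distributionally scrambled of type 2. -/
def DistScrambled2 {Y : Type*} (d : Y → Y → ℝ) (f : Y → Y) (x y : Y) : Prop :=
  (∃ s > 0, Fdist d f x y s < 1) ∧ ∀ s > 0, FdistStar d f x y s = 1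

/-- `x, y` are distributionally scrambled of type 3. -/
def DistScrambled3 {Y : Type*} (d : Y → Y → ℝ) (f : Y → Y) (x y : Y) : Prop :=
  ∃ a b : ℝ, 0 < a ∧ a < b ∧ ∀ s ∈ Set.Icc a b, Fdist d f x y s < FdistStar d f x y s

/-- `A` is a distributionally scrambled set of type 1: it has at least two elements and all
pairs of distinct points of `A` are distributionally scrambled of type 1. -/
def DistScrambledSet1 {Y : Type*} (d : Y → Y → ℝ) (f : Y → Y) (A : Set Y) : Prop :=
  A.Nontrivial ∧ ∀ x ∈ A, ∀ y ∈ A, x ≠ y → DistScrambled1 d f x y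

/-- `A` is a distributionally scrambled set of type 2. -/
def DistScrambledSet2 {Y : Type*} (d : Y → Y → ℝ) (f : Y → Y) (A : Set Y) : Prop :=
  A.Nontrivial ∧ ∀ x ∈ A, ∀ y ∈ A, x ≠ y → DistScrambled2 d f x y

/-- `A` is a distributionally scrambled set of type 3. -/
def DistScrambledSet3 {Y : Type*} (d : Y → Y → ℝ) (f : Y → Y) (A : Set Y) : Prop :=
  A.Nontrivial ∧ ∀ x ∈ A, ∀ y ∈ A, x ≠ y → DistScrambled3 d f x y

/-- `(Y,f)` is uniform distributionally chaotic: there is an uncountable distributionally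
scrambled set `A` of type 1 and a single `ε > 0` with `F_{xy}(ε) = 0` for distinct `x,y ∈ A`. -/
def UniformDC {Y : Type*} (d : Y → Y → ℝ) (f : Y → Y) : Prop :=
  ∃ A : Set Y, ¬ A.Countable ∧ DistScrambledSet1 d f A ∧
    ∃ ε > 0, ∀ x ∈ A, ∀ y ∈ A, x ≠ y → Fdist d f x y ε = 0

/-- `a` is a transitive point of `f`: its forward orbit is dense. -/
def TransitivePoint {Y : Type*} [TopologicalSpace Y] (f : Y → Y) (a : Y) : Prop :=
  Dense (Set.range fun n : ℕ => f^[n] a)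

/-- `(Y,f)` is dense distributionally chaotic: uniform distributional chaos witnessed by a
dense set. -/
def DenseDC {Y : Type*} [TopologicalSpace Y] (d : Y → Y → ℝ) (f : Y → Y) : Prop :=
  ∃ A : Set Y, ¬ A.Countable ∧ Dense A ∧ DistScrambledSet1 d f A ∧
    ∃ ε > 0, ∀ x ∈ A, ∀ y ∈ A, x ≠ y → Fdist d f x y ε = 0

/-- `(Y,f)` is transitive distributionally chaotic: uniform distributional chaos witnessed by a
dense set of transitive points. -/
def TransitiveDC {Y : Type*} [TopologicalSpace Y] (d : Y → Y → ℝ) (f : Y → Y) : Prop :=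
  ∃ A : Set Y, ¬ A.Countable ∧ Dense A ∧ (∀ a ∈ A, TransitivePoint f a) ∧
    DistScrambledSet1 d f A ∧
    ∃ ε > 0, ∀ x ∈ A, ∀ y ∈ A, x ≠ y → Fdist d f x y ε = 0

/-- The ω-limit set of `a` under `f`: all limits of `f^[n k] a` along strictly increasing
sequences `n`. -/
def OmegaSet {Y : Type*} [TopologicalSpace Y] (f : Y → Y) (a : Y) : Set Y :=
  {z | ∃ n : ℕ → ℕ, StrictMono n ∧ Tendsto (fun k => f^[n k] a) atTop (nhds z)}

/-- The set of periodic points of `f`. -/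
def PerSet {Y : Type*} (f : Y → Y) : Set Y := {y | ∃ n ≥ 1, f^[n] y = y}

/-- `x, y` are `ω^u`-scrambled. -/
def OmegaUScrambled {Y : Type*} [TopologicalSpace Y] (f : Y → Y) (x y : Y) : Prop :=
  ¬ (OmegaSet f x \ OmegaSet f y).Countable ∧
    (OmegaSet f x ∩ OmegaSet f y).Nonempty ∧ (OmegaSet f x \ PerSet f).Nonempty

/-- `x, y` are `ω^∞`-scrambled. -/
def OmegaInfScrambled {Y : Type*} [TopologicalSpace Y] (f : Y → Y) (x y : Y) : Prop :=
  (OmegaSet f x \ OmegaSet f y).Infinite ∧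
    (OmegaSet f x ∩ OmegaSet f y).Nonempty ∧ (OmegaSet f x \ PerSet f).Nonempty

/-- `A` is an `ω^u`-scrambled set. -/
def OmegaUScrambledSet {Y : Type*} [TopologicalSpace Y] (f : Y → Y) (A : Set Y) : Prop :=
  A.Nontrivial ∧ ∀ x ∈ A, ∀ y ∈ A, x ≠ y → OmegaUScrambled f x y

/-- `A` is an `ω^∞`-scrambled set. -/
def OmegaInfScrambledSet {Y : Type*} [TopologicalSpace Y] (f : Y → Y) (A : Set Y) : Prop :=
  A.Nontrivial ∧ ∀ x ∈ A, ∀ y ∈ A, x ≠ y → OmegaInfScrambled f x y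

/-- A map without periodic points admits a height function that increases by one along `φ`. -/
lemma exists_height_of_no_periodicPt {Γ : Type*} (φ : Γ → Γ) (hper : ∀ θ : Γ, ¬ PeriodicPt φ θ) :
    ∃ h : Γ → ℤ, ∀ α, h (φ α) = h α + 1 := by
  have inj : ∀ (θ : Γ) (a b : ℕ), φ^[a] θ = φ^[b] θ → a = b := by
    have key : ∀ (θ : Γ) (a b : ℕ), a < b → φ^[a] θ ≠ φ^[b] θ := by
      intro θ a b hab h
      refine hper (φ^[a] θ) ⟨b - a, by omega, ?_⟩
      rw [← Function.iterate_add_apply, Nat.sub_add_cancel hab.le, h]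
    intro θ a b h
    rcases lt_trichotomy a b with hab | hab | hab
    · exact absurd h (key θ a b hab)
    · exact hab
    · exact absurd h.symm (key θ b a hab)
  let S : Setoid Γ :=
    { r := fun α β => ∃ m n : ℕ, φ^[m] α = φ^[n] β
      iseqv :=
        { refl := fun _ => ⟨0, 0, rfl⟩
          symm := fun ⟨m, n, h⟩ => ⟨n, m, h.symm⟩
          trans := by
            rintro α β γ ⟨m, n, h⟩ ⟨p, q, h'⟩
            refine ⟨p + m, n + q, ?_⟩
            rw [Function.iterate_add_apply, h, ← Function.iterate_add_apply, add_comm p n,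
              Function.iterate_add_apply, h', ← Function.iterate_add_apply] } }
  let rep : Γ → Γ := fun α => (Quotient.mk S α).out
  have hrep : ∀ α, ∃ m n : ℕ, φ^[m] α = φ^[n] (rep α) := fun α =>
    S.symm (Quotient.exact (Quotient.out_eq (Quotient.mk S α)))
  have hrepφ : ∀ α, rep (φ α) = rep α := by
    intro α
    have : Quotient.mk S (φ α) = Quotient.mk S α := Quotient.sound ⟨0, 1, rfl⟩
    simp only [rep, this]
  choose m n hmn using hrep
  refine ⟨fun α => (n α : ℤ) - m α, fun α => ?_⟩
  have h1 := hmn α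
  have h2 := hmn (φ α)
  rw [hrepφ, ← Function.iterate_succ_apply] at h2
  have h3 : φ^[m (φ α) + 1 + n α] (rep α) = φ^[m α + n (φ α)] (rep α) := by
    rw [Function.iterate_add_apply, ← h1, Function.iterate_add_apply φ (m α), ← h2]
    exact Function.Commute.iterate_iterate_self φ _ _ α
  have := inj _ _ _ h3
  dsimp only
  omega

lemma height_iterate {Γ : Type*} {φ : Γ → Γ} {h : Γ → ℤ} (hh : ∀ α, h (φ α) = h α + 1)
    (i : ℕ) (α : Γ) : h (φ^[i] α) = h α + i := by
  induction i with
  | zero => simp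
  | succ i ih =>
    rw [Function.iterate_succ_apply', hh, ih]
    push_cast
    ring

lemma genShift_iterate {X Γ : Type*} (φ : Γ → Γ) (n : ℕ) (x : Γ → X) (α : Γ) :
    (genShift φ)^[n] x α = x (φ^[n] α) := by
  induction n generalizing x with
  | zero => rfl
  | succ n ih => rw [Function.iterate_succ_apply, ih, Function.iterate_succ_apply']; rfl

lemma IsCompatibleMetric.continuous {Y : Type*} [t : TopologicalSpace Y] {d : Y → Y → ℝ}
    (hd : IsCompatibleMetric Y d) : Continuous fun p : Y × Y => d p.1 p.2 := by
  obtain ⟨m, rfl, hm⟩ := hd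
  simp_rw [← hm]
  exact continuous_dist

lemma IsCompatibleMetric.pos {Y : Type*} [t : TopologicalSpace Y] {d : Y → Y → ℝ}
    (hd : IsCompatibleMetric Y d) {x y : Y} (hxy : x ≠ y) : 0 < d x y := by
  obtain ⟨m, rfl, hm⟩ := hd
  rw [← hm]
  exact dist_pos.2 hxy

lemma isOpen_setOf_apply_ne {X Γ : Type*} [TopologicalSpace X] [DiscreteTopology X] (α : Γ) :
    IsOpen {p : (Γ → X) × (Γ → X) | p.1 α ≠ p.2 α} :=
  (isOpen_discrete {q : X × X | q.1 ≠ q.2}).preimage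
    (f := fun p : (Γ → X) × (Γ → X) => (p.1 α, p.2 α)) (by fun_prop)

/-- Points agreeing on a suitable finite set of coordinates are close for a compatible metric. -/
lemma IsCompatibleMetric.exists_finset_lt {X Γ : Type*} [Finite X] [TopologicalSpace X]
    [DiscreteTopology X] {d : (Γ → X) → (Γ → X) → ℝ} (hd : IsCompatibleMetric (Γ → X) d)
    {t : ℝ} (ht : 0 < t) :
    ∃ D : Finset Γ, ∀ x y : Γ → X, (∀ α ∈ D, x α = y α) → d x y < t := by
  have hpos : ∀ x : Γ → X, d x x = 0 := by
    obtain ⟨m, -, hm⟩ := hd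
    intro x
    rw [← hm]
    exact m.dist_self x
  have hK : IsCompact {p : (Γ → X) × (Γ → X) | t ≤ d p.1 p.2} :=
    (isClosed_le continuous_const hd.continuous).isCompact
  obtain ⟨D, hD⟩ := hK.elim_finite_subcover
    (fun α : Γ => {p : (Γ → X) × (Γ → X) | p.1 α ≠ p.2 α}) isOpen_setOf_apply_ne (by
      rintro ⟨x, y⟩ hxy
      simp only [Set.mem_ofPred_eq] at hxy
      have hne : x ≠ y := by
        rintro rfl
        linarith [hpos x]
      simpa using Function.ne_iff.1 hne)
  refine ⟨D, fun x y hxy => ?_⟩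
  by_contra! hlt
  have := hD (show (x, y) ∈ {p : (Γ → X) × (Γ → X) | t ≤ d p.1 p.2} from hlt)
  simp only [Set.mem_iUnion, Set.mem_ofPred_eq] at this
  obtain ⟨α, hα, hne⟩ := this
  exact hne (hxy α hα)

/-- Points differing at a fixed coordinate are uniformly separated for a compatible metric. -/
lemma IsCompatibleMetric.exists_pos_le_of_apply_ne {X Γ : Type*} [Finite X] [TopologicalSpace X]
    [DiscreteTopology X] {d : (Γ → X) → (Γ → X) → ℝ} (hd : IsCompatibleMetric (Γ → X) d)
    (α : Γ) : ∃ r > 0, ∀ x y : Γ → X, x α ≠ y α → r ≤ d x y := by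
  have hclosed : IsClosed {p : (Γ → X) × (Γ → X) | p.1 α ≠ p.2 α} :=
    (isClosed_discrete {q : X × X | q.1 ≠ q.2}).preimage
      (f := fun p : (Γ → X) × (Γ → X) => (p.1 α, p.2 α)) (by fun_prop)
  rcases Set.eq_empty_or_nonempty {p : (Γ → X) × (Γ → X) | p.1 α ≠ p.2 α} with he | hne
  · refine ⟨1, one_pos, fun x y hxy => ?_⟩
    have : (x, y) ∈ {p : (Γ → X) × (Γ → X) | p.1 α ≠ p.2 α} := hxy
    simp [he] at this
  · obtain ⟨p, hp, hmin⟩ := hclosed.isCompact.exists_isMinOn hne hd.continuous.continuousOn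
    refine ⟨d p.1 p.2, hd.pos fun h => hp (congrFun h α), fun x y hxy => ?_⟩
    exact hmin (show (x, y) ∈ {p : (Γ → X) × (Γ → X) | p.1 α ≠ p.2 α} from hxy)

lemma ncard_lt_and_le (P : ℕ → Prop) (n : ℕ) : {i | i < n ∧ P i}.ncard ≤ n := by
  calc _ ≤ (Set.Iio n).ncard := Set.ncard_le_ncard (fun i hi => hi.1) (Set.finite_Iio n)
    _ = n := by simp [Set.ncard_eq_toFinset_card']

lemma div_nat_mem_unitInterval {c n : ℕ} (h : c ≤ n) :
    0 ≤ (c : ℝ) / n ∧ (c : ℝ) / n ≤ 1 :=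
  ⟨by positivity, div_le_one_of_le₀ (by exact_mod_cast h) (by positivity)⟩

lemma eventually_factorial_add_le (k : ℕ) {ε : ℝ} (hε : 0 < ε) :
    ∀ᶠ j : ℕ in atTop, (j.factorial : ℝ) + 2 * k ≤ ε * (j + 1).factorial := by
  obtain ⟨N, hN⟩ := exists_nat_ge ((1 + 2 * k) / ε)
  filter_upwards [eventually_ge_atTop N] with j hj
  have h1 : (1 : ℝ) ≤ j.factorial := by exact_mod_cast Nat.factorial_pos j
  have h2 : (1 + 2 * k : ℝ) ≤ ε * (j + 1) := by
    rw [div_le_iff₀ hε] at hN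
    have : (N : ℝ) ≤ j := by exact_mod_cast hj
    nlinarith
  rw [Nat.factorial_succ]
  push_cast
  have hk : (0 : ℝ) ≤ k := by positivity
  nlinarith

/-- If `P` holds on infinitely many intervals `[j! + k, (j+1)! - k)`, its upper density is one. -/
lemma limsup_ncard_div_eq_one {P : ℕ → Prop} (k : ℕ)
    (hP : ∃ᶠ j in atTop, ∀ i, j.factorial + k ≤ i → i + k < (j + 1).factorial → P i) :
    limsup (fun n : ℕ => ({i | i < n ∧ P i}.ncard : ℝ) / n) atTop = 1 := by
  have hb : ∀ n : ℕ, 0 ≤ ({i | i < n ∧ P i}.ncard : ℝ) / n ∧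
      ({i | i < n ∧ P i}.ncard : ℝ) / n ≤ 1 := fun n =>
    div_nat_mem_unitInterval (ncard_lt_and_le P n)
  apply le_antisymm
  · exact limsup_le_of_le
      (isCoboundedUnder_le_of_le atTop (x := 0) fun n => (hb n).1)
      (Eventually.of_forall fun n => (hb n).2)
  · refine le_of_forall_pos_le_add fun ε hε => ?_
    rw [← sub_le_iff_le_add]
    refine le_limsup_of_frequently_le ?_ (isBoundedUnder_of ⟨1, fun n => (hb n).2⟩)
    have hsucc : Tendsto (fun j : ℕ => (j + 1).factorial) atTop atTop :=
      tendsto_atTop_mono (fun j => (Nat.le_succ j).trans (Nat.self_le_factorial _)) tendsto_id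
    refine hsucc.frequently ((hP.and_eventually (eventually_factorial_add_le k hε)).mono ?_)
    rintro j ⟨hj, hε'⟩
    have hcard : (j + 1).factorial ≤
        {i | i < (j + 1).factorial ∧ P i}.ncard + (j.factorial + 2 * k) := by
      have : (Set.Ico (j.factorial + k) ((j + 1).factorial - k)).ncard ≤
          {i | i < (j + 1).factorial ∧ P i}.ncard := by
        refine Set.ncard_le_ncard (fun i hi => ?_)
          ((Set.finite_Iio (j + 1).factorial).subset fun i hi => hi.1)
        simp only [Set.mem_Ico] at hi
        exact ⟨by omega, hj i hi.1 (by omega)⟩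
      rw [Set.ncard_eq_toFinset_card'] at this
      simp only [Set.toFinset_Ico, Nat.card_Ico] at this
      omega
    have hpos : (0 : ℝ) < (j + 1).factorial := by exact_mod_cast Nat.factorial_pos _
    rw [le_div_iff₀ hpos]
    have : ((j + 1).factorial : ℝ) ≤
        ({i | i < (j + 1).factorial ∧ P i}.ncard : ℝ) + (j.factorial + 2 * k) := by
      exact_mod_cast hcard
    linarith

/-- If `P` fails on infinitely many intervals `[j! + k, (j+1)! - k)`, its lower density is zero. -/
lemma liminf_ncard_div_eq_zero {P : ℕ → Prop} (k : ℕ)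
    (hP : ∃ᶠ j in atTop, ∀ i, j.factorial + k ≤ i → i + k < (j + 1).factorial → ¬ P i) :
    liminf (fun n : ℕ => ({i | i < n ∧ P i}.ncard : ℝ) / n) atTop = 0 := by
  have hb : ∀ n : ℕ, 0 ≤ ({i | i < n ∧ P i}.ncard : ℝ) / n ∧
      ({i | i < n ∧ P i}.ncard : ℝ) / n ≤ 1 := fun n =>
    div_nat_mem_unitInterval (ncard_lt_and_le P n)
  apply le_antisymm
  · refine le_of_forall_pos_le_add fun ε hε => ?_
    rw [zero_add]
    refine liminf_le_of_frequently_le ?_ (isBoundedUnder_of ⟨0, fun n => (hb n).1⟩)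
    have hsucc : Tendsto (fun j : ℕ => (j + 1).factorial) atTop atTop :=
      tendsto_atTop_mono (fun j => (Nat.le_succ j).trans (Nat.self_le_factorial _)) tendsto_id
    refine hsucc.frequently ((hP.and_eventually (eventually_factorial_add_le k hε)).mono ?_)
    rintro j ⟨hj, hε'⟩
    have hcard : {i | i < (j + 1).factorial ∧ P i}.ncard ≤ j.factorial + 2 * k := by
      have hsub : {i | i < (j + 1).factorial ∧ P i} ⊆
          ↑(Finset.range (j.factorial + k) ∪
            Finset.Ico ((j + 1).factorial - k) (j + 1).factorial) := by
        rintro i ⟨hi, hPi⟩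
        have := fun h1 h2 => hj i h1 h2 hPi
        simp only [Finset.coe_union, Set.mem_union, Finset.mem_coe, Finset.mem_range,
          Finset.mem_Ico]
        by_contra! hcon
        exact this hcon.1 (by have := hcon.2; omega)
      refine (Set.ncard_le_ncard hsub (Finset.finite_toSet _)).trans ?_
      rw [Set.ncard_coe_finset]
      refine (Finset.card_union_le _ _).trans ?_
      simp only [Finset.card_range, Nat.card_Ico]
      omega
    have hpos : (0 : ℝ) < (j + 1).factorial := by exact_mod_cast Nat.factorial_pos _
    rw [div_le_iff₀ hpos]
    have : ({i | i < (j + 1).factorial ∧ P i}.ncard : ℝ) ≤ j.factorial + 2 * k := by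
      exact_mod_cast hcard
    linarith
  · exact le_liminf_of_le
      (isCoboundedUnder_ge_of_le atTop (x := 1) fun n => (hb n).2)
      (Eventually.of_forall fun n => (hb n).1)

/-- The index `j` of the factorial block `[j!, (j+1)!)` containing `t`. -/
def factorialBlock (t : ℤ) : ℕ :=
  Nat.findGreatest (fun j => j.factorial ≤ t.toNat) t.toNat

lemma factorialBlock_eq {t : ℤ} {j : ℕ} (h1 : (j.factorial : ℤ) ≤ t)
    (h2 : t < (j + 1).factorial) : factorialBlock t = j := by
  rw [factorialBlock, Nat.findGreatest_eq_iff]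
  have h3 : j.factorial ≤ t.toNat := by omega
  refine ⟨(Nat.self_le_factorial j).trans h3, fun _ => h3, fun n hn _ hle => ?_⟩
  have := Nat.factorial_le (Nat.succ_le_of_lt hn)
  simp only [Nat.succ_eq_add_one] at this
  omega

/-- Every residue modulo `3` and every label is attained by arbitrarily late blocks. -/
lemma frequently_block (c i : ℕ) (hc : c < 3) :
    ∃ᶠ j in atTop, j % 3 = c ∧ (Nat.unpair (j / 3)).1 = i := by
  rw [frequently_atTop]
  intro N
  refine ⟨3 * Nat.pair i N + c, ?_, by omega, ?_⟩
  · have := Nat.right_le_pair i N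
    omega
  · rw [show (3 * Nat.pair i N + c) / 3 = Nat.pair i N by omega, Nat.unpair_pair]

/-- A point whose coordinates at height in the `j`-th factorial block are, according to `j % 3`,
constantly `a`, a coding of one digit of `s`, or a shifted copy of one of the points `w i`. -/
noncomputable def blockPoint {X Γ : Type*} [Nonempty Γ] (φ : Γ → Γ) (h : Γ → ℤ) (a b : X)
    (w : ℕ → Γ → X) (s : ℕ → Bool) (α : Γ) : X :=
  let j := factorialBlock (h α)
  if j % 3 = 0 then a
  else if j % 3 = 1 then (if s (Nat.unpair (j / 3)).1 then a else b)
  else w (Nat.unpair (j / 3)).1 (Function.invFun (φ^[j.factorial + j]) α)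

lemma factorialBlock_height_iterate {Γ : Type*} {φ : Γ → Γ} {h : Γ → ℤ}
    (hh : ∀ α, h (φ α) = h α + 1) {α : Γ} {i j k : ℕ} (hk : (h α).natAbs ≤ k)
    (h1 : j.factorial + k ≤ i) (h2 : i + k < (j + 1).factorial) :
    factorialBlock (h (φ^[i] α)) = j := by
  rw [height_iterate hh]
  exact factorialBlock_eq (by omega) (by omega)

lemma exists_height_bound {Γ : Type*} (h : Γ → ℤ) (D : Finset Γ) :
    ∃ k : ℕ, ∀ α ∈ D, (h α).natAbs ≤ k :=
  ⟨D.sup fun α => (h α).natAbs, fun _ hα => Finset.le_sup (f := fun α => (h α).natAbs) hα⟩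

lemma factorial_add_two_mul_lt {j : ℕ} (hj : 3 ≤ j) :
    j.factorial + j + j < (j + 1).factorial := by
  have h1 : 3 ≤ j.factorial := hj.trans (Nat.self_le_factorial j)
  rw [Nat.factorial_succ]
  nlinarith

lemma transitivePoint_blockPoint {X Γ : Type*} [TopologicalSpace X] [DiscreteTopology X]
    [Nonempty Γ] {φ : Γ → Γ} (hinj : Function.Injective φ) {h : Γ → ℤ}
    (hh : ∀ α, h (φ α) = h α + 1) (a b : X) {w : ℕ → Γ → X} (hw : DenseRange w)
    (s : ℕ → Bool) : TransitivePoint (genShift φ) (blockPoint φ h a b w s) := by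
  rw [TransitivePoint, dense_iff_inter_open]
  rintro U hU hne
  obtain ⟨z, hz, i, rfl⟩ := hw.inter_open_nonempty U hU hne
  obtain ⟨D, u, hDu, hsub⟩ := isOpen_pi_iff.1 hU _ hz
  obtain ⟨k, hk⟩ := exists_height_bound h D
  obtain ⟨j, ⟨hj3, hji⟩, hjk⟩ := ((frequently_block 2 i (by norm_num)).and_eventually
    (eventually_ge_atTop (max k 3))).exists
  have hlt := factorial_add_two_mul_lt ((le_max_right k 3).trans hjk)
  have hkj := (le_max_left k 3).trans hjk
  refine ⟨_, hsub ?_, j.factorial + j, rfl⟩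
  intro α hα
  have hblock := factorialBlock_height_iterate hh (hk α hα) (i := j.factorial + j) (j := j)
    (by omega) (by omega)
  simp only [genShift_iterate, blockPoint, hblock, hj3, hji]
  rw [Function.leftInverse_invFun (hinj.iterate _) α]
  exact (hDu α hα).2

variable {X : Type*} [Fintype X] [TopologicalSpace X] [DiscreteTopology X] [Nontrivial X]
variable {Γ : Type*} [Countable Γ] [Nonempty Γ]
/-- if `φ` is one-to-one with no periodic point, then for any compatible
metric `d` on `X^Γ` there are an uncountable set `M` of transitive points of `σ_φ` and
`r > 0` with `F*_{xy}(t) = 1` for all `t > 0` and `F_{xy}(r) = 0` for all distinct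
`x, y ∈ M`. -/
theorem exists_uncountable_transitive_scrambled_of_injective_no_periodicPt
    (φ : Γ → Γ) (hinj : Function.Injective φ) (hper : ∀ θ : Γ, ¬ PeriodicPt φ θ)
    (d : (Γ → X) → (Γ → X) → ℝ) (hd : IsCompatibleMetric (Γ → X) d) :
    ∃ M : Set (Γ → X), ¬ M.Countable ∧
      (∀ a ∈ M, TransitivePoint (genShift (X := X) φ) a) ∧
      ∃ r > (0 : ℝ), ∀ x ∈ M, ∀ y ∈ M, x ≠ y →
        (∀ t > (0 : ℝ), FdistStar d (genShift (X := X) φ) x y t = 1) ∧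
        Fdist d (genShift (X := X) φ) x y r = 0 := by
  obtain ⟨h, hh⟩ := exists_height_of_no_periodicPt φ hper
  obtain ⟨a, b, hab⟩ := exists_pair_ne X
  obtain ⟨w, hw⟩ := TopologicalSpace.exists_dense_seq (Γ → X)
  obtain ⟨α₀⟩ := ‹Nonempty Γ›
  obtain ⟨r, hr, hsep⟩ := hd.exists_pos_le_of_apply_ne α₀
  have hne : ∀ s s' : ℕ → Bool, s ≠ s' → ∃ᶠ j in atTop, ∀ i,
      j.factorial + (h α₀).natAbs ≤ i → i + (h α₀).natAbs < (j + 1).factorial →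
      blockPoint φ h a b w s (φ^[i] α₀) ≠ blockPoint φ h a b w s' (φ^[i] α₀) := by
    intro s s' hss
    obtain ⟨m, hm⟩ := Function.ne_iff.1 hss
    refine (frequently_block 1 m (by norm_num)).mono ?_
    rintro j ⟨hj3, hjm⟩ i h1 h2
    have hblock := factorialBlock_height_iterate hh le_rfl h1 h2
    simp only [blockPoint, hblock, hj3, hjm]
    cases hs : s m <;> cases hs' : s' m <;> simp [hs, hs', hab, hab.symm] at hm ⊢
  have hinjP : Function.Injective (blockPoint φ h a b w) := by
    intro s s' heq
    by_contra hss
    obtain ⟨j, hj, hj'⟩ := ((hne s s' hss).and_eventually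
      (eventually_ge_atTop (max (h α₀).natAbs 3))).exists
    have hlt := factorial_add_two_mul_lt ((le_max_right _ 3).trans hj')
    have hkj := (le_max_left _ 3).trans hj'
    exact hj (j.factorial + j) (by omega) (by omega) (by rw [heq])
  refine ⟨Set.range (blockPoint φ h a b w), ?_, ?_, r, hr, ?_⟩
  · intro hc
    have : Countable (ℕ → Bool) :=
      (Set.countable_univ_iff).1 (Set.countable_of_injective_of_countable_image
        hinjP.injOn (by rwa [Set.image_univ]))
    have hle := Cardinal.mk_le_aleph0 (α := ℕ → Bool)
    rw [← Cardinal.power_def, Cardinal.mk_bool, Cardinal.mk_nat, Cardinal.two_power_aleph0] at hle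
    exact Cardinal.aleph0_lt_continuum.not_ge hle
  · rintro _ ⟨s, rfl⟩
    exact transitivePoint_blockPoint hinj hh a b hw s
  · rintro _ ⟨s, rfl⟩ _ ⟨s', rfl⟩ hxy
    refine ⟨fun t ht => ?_, ?_⟩
    · obtain ⟨D, hD⟩ := hd.exists_finset_lt ht
      obtain ⟨k, hk⟩ := exists_height_bound h D
      refine limsup_ncard_div_eq_one k ((frequently_block 0 0 (by norm_num)).mono ?_)
      rintro j ⟨hj3, -⟩ i h1 h2
      refine hD _ _ fun α hα => ?_
      have hblock := factorialBlock_height_iterate hh (hk α hα) h1 h2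
      simp only [genShift_iterate, blockPoint, hblock, hj3, if_true]
    · refine liminf_ncard_div_eq_zero (h α₀).natAbs 
        ((hne s s' fun hs => hxy (by rw [hs])).mono ?_)
      intro j hj i h1 h2
      refine not_lt.2 (hsep _ _ ?_)
      simpa only [genShift_iterate] using hj i h1 h2
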